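/- Let A and B be k-algebras and let τ : B ⊗ A → A ⊗ B be a bijective k-linear map satisfying the unit conditions τ(b ⊗ 1) = 1 ⊗ b and τ(1 ⊗ a) = a ⊗ 1 for all a ∈ A, b ∈ B. Then the multiplicativity condition τ ∘ (∇_B ⊗ ∇_A) = (∇_A ⊗ ∇_B) ∘ (1 ⊗ τ ⊗ 1) ∘ (τ ⊗ τ) ∘ (1 ⊗ τ ⊗ 1) holds if and only if both of the following hold: τ ∘ (1_B ⊗ ∇_A) = (∇_A ⊗ 1_B) ∘ (1_A ⊗ τ) ∘ (τ ⊗ 1_A) as maps B ⊗ A ⊗ A → A ⊗ B, and τ ∘ (∇_B ⊗ 1_A) = (1_A ⊗ ∇_B) ∘ (τ ⊗ 1_B) ∘ (1_B ⊗ τ) as maps B ⊗ B ⊗ A → A ⊗ B. -/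

import Mathlib

open TensorProduct

section TTPDefs

variable (k : Type*) [Field k]
variable {A B : Type*} [AddCommGroup A] [Module k A] [AddCommGroup B] [Module k B]

/-- The rearrangement `1 ⊗ τ ⊗ 1 : (A ⊗ B) ⊗ (A ⊗ B) → (A ⊗ A) ⊗ (B ⊗ B)`. -/
noncomputable def middleTwist (τ : B ⊗[k] A →ₗ[k] A ⊗[k] B) :
    (A ⊗[k] B) ⊗[k] (A ⊗[k] B) →ₗ[k] (A ⊗[k] A) ⊗[k] (B ⊗[k] B) :=
  (TensorProduct.assoc k A A (B ⊗[k] B)).symm.toLinearMap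
    ∘ₗ TensorProduct.map (LinearMap.id : A →ₗ[k] A) (TensorProduct.assoc k A B B).toLinearMap
    ∘ₗ TensorProduct.map (LinearMap.id : A →ₗ[k] A)
        (TensorProduct.map τ (LinearMap.id : B →ₗ[k] B))
    ∘ₗ TensorProduct.map (LinearMap.id : A →ₗ[k] A)
        (TensorProduct.assoc k B A B).symm.toLinearMap
    ∘ₗ (TensorProduct.assoc k A B (A ⊗[k] B)).toLinearMap

/-- The twisted tensor product multiplication `∇_τ = (mA ⊗ mB) ∘ (1 ⊗ τ ⊗ 1)` on `A ⊗ B`,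
for given multiplication maps `mA`, `mB`. -/
noncomputable def ttpMul (mA : A ⊗[k] A →ₗ[k] A) (mB : B ⊗[k] B →ₗ[k] B)
    (τ : B ⊗[k] A →ₗ[k] A ⊗[k] B) :
    (A ⊗[k] B) ⊗[k] (A ⊗[k] B) →ₗ[k] A ⊗[k] B :=
  TensorProduct.map mA mB ∘ₗ middleTwist k τ

/-- The rearrangement `1 ⊗ τ ⊗ 1 : (B ⊗ B) ⊗ (A ⊗ A) → (B ⊗ A) ⊗ (B ⊗ A)`. -/
noncomputable def preTwist (τ : B ⊗[k] A →ₗ[k] A ⊗[k] B) :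
    (B ⊗[k] B) ⊗[k] (A ⊗[k] A) →ₗ[k] (B ⊗[k] A) ⊗[k] (B ⊗[k] A) :=
  (TensorProduct.assoc k B A (B ⊗[k] A)).symm.toLinearMap
    ∘ₗ TensorProduct.map (LinearMap.id : B →ₗ[k] B) (TensorProduct.assoc k A B A).toLinearMap
    ∘ₗ TensorProduct.map (LinearMap.id : B →ₗ[k] B)
        (TensorProduct.map τ (LinearMap.id : A →ₗ[k] A))
    ∘ₗ TensorProduct.map (LinearMap.id : B →ₗ[k] B)
        (TensorProduct.assoc k B A A).symm.toLinearMap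
    ∘ₗ (TensorProduct.assoc k B B (A ⊗[k] A)).toLinearMap

/-- `τ : B ⊗ A → A ⊗ B` is a twisting map with respect to the given units `uA`, `uB` and
multiplication maps `mA`, `mB`: it is bijective, compatible with the units, and
`τ ∘ (mB ⊗ mA) = (mA ⊗ mB) ∘ (1 ⊗ τ ⊗ 1) ∘ (τ ⊗ τ) ∘ (1 ⊗ τ ⊗ 1)`. -/
def IsTwistingMapGen (uA : A) (mA : A ⊗[k] A →ₗ[k] A) (uB : B) (mB : B ⊗[k] B →ₗ[k] B)
    (τ : B ⊗[k] A →ₗ[k] A ⊗[k] B) : Prop :=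
  Function.Bijective τ ∧
  (∀ b : B, τ (b ⊗ₜ[k] uA) = uA ⊗ₜ[k] b) ∧
  (∀ a : A, τ (uB ⊗ₜ[k] a) = a ⊗ₜ[k] uB) ∧
  τ ∘ₗ TensorProduct.map mB mA
    = ttpMul k mA mB τ ∘ₗ TensorProduct.map τ τ ∘ₗ preTwist k τ

end TTPDefs

/-- A twisting map between two `k`-algebras `A` and `B`. -/
def IsTwistingMap (k : Type*) [Field k] {A B : Type*}
    [Ring A] [Algebra k A] [Ring B] [Algebra k B]
    (τ : B ⊗[k] A →ₗ[k] A ⊗[k] B) : Prop :=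
  IsTwistingMapGen k (1 : A) (LinearMap.mul' k A) (1 : B) (LinearMap.mul' k B) τ

section TwistingMapHelpers

variable {k A B : Type*} [Field k] [Ring A] [Algebra k A] [Ring B] [Algebra k B]

/-- `(∇_A ⊗ 1_B) ∘ (1_A ⊗ τ)`, the extension of `τ` to a left `A`-linear map. -/
noncomputable def twistLeft (τ : B ⊗[k] A →ₗ[k] A ⊗[k] B) :
    (A ⊗[k] B) ⊗[k] A →ₗ[k] A ⊗[k] B :=
  TensorProduct.map (LinearMap.mul' k A) (LinearMap.id : B →ₗ[k] B)
    ∘ₗ (TensorProduct.assoc k A A B).symm.toLinearMap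
    ∘ₗ TensorProduct.map (LinearMap.id : A →ₗ[k] A) τ
    ∘ₗ (TensorProduct.assoc k A B A).toLinearMap

/-- `(1_A ⊗ ∇_B) ∘ (τ ⊗ 1_B)`, the extension of `τ` to a right `B`-linear map. -/
noncomputable def twistRight (τ : B ⊗[k] A →ₗ[k] A ⊗[k] B) :
    B ⊗[k] (A ⊗[k] B) →ₗ[k] A ⊗[k] B :=
  TensorProduct.map (LinearMap.id : A →ₗ[k] A) (LinearMap.mul' k B)
    ∘ₗ (TensorProduct.assoc k A B B).toLinearMap
    ∘ₗ TensorProduct.map τ (LinearMap.id : B →ₗ[k] B)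
    ∘ₗ (TensorProduct.assoc k B A B).symm.toLinearMap

theorem twistLeft_tmul (τ : B ⊗[k] A →ₗ[k] A ⊗[k] B) (a a' : A) (b : B) :
    twistLeft τ ((a ⊗ₜ b) ⊗ₜ a')
      = TensorProduct.map (LinearMap.mulLeft k a) LinearMap.id (τ (b ⊗ₜ a')) := by
  simp only [twistLeft, LinearMap.comp_apply, LinearEquiv.coe_coe, TensorProduct.assoc_tmul,
    TensorProduct.map_tmul, LinearMap.id_apply]
  induction τ (b ⊗ₜ a') using TensorProduct.induction_on with
  | zero => simp
  | tmul x y => simp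
  | add x y hx hy => simp only [TensorProduct.tmul_add, map_add, hx, hy]

theorem twistRight_tmul (τ : B ⊗[k] A →ₗ[k] A ⊗[k] B) (a : A) (b b' : B) :
    twistRight τ (b ⊗ₜ (a ⊗ₜ b'))
      = TensorProduct.map LinearMap.id (LinearMap.mulRight k b') (τ (b ⊗ₜ a)) := by
  simp only [twistRight, LinearMap.comp_apply, LinearEquiv.coe_coe,
    TensorProduct.assoc_symm_tmul, TensorProduct.map_tmul, LinearMap.id_apply]
  induction τ (b ⊗ₜ a) using TensorProduct.induction_on with
  | zero => simp
  | tmul x y => simp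
  | add x y hx hy => simp only [TensorProduct.add_tmul, map_add, hx, hy]

theorem ttpMul_tmul (τ : B ⊗[k] A →ₗ[k] A ⊗[k] B) (a a' : A) (b b' : B) :
    ttpMul k (LinearMap.mul' k A) (LinearMap.mul' k B) τ ((a ⊗ₜ b) ⊗ₜ (a' ⊗ₜ b'))
      = TensorProduct.map (LinearMap.mulLeft k a) (LinearMap.mulRight k b') (τ (b ⊗ₜ a')) := by
  simp only [ttpMul, middleTwist, LinearMap.comp_apply, LinearEquiv.coe_coe,
    TensorProduct.assoc_tmul, TensorProduct.assoc_symm_tmul, TensorProduct.map_tmul,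
    LinearMap.id_apply]
  induction τ (b ⊗ₜ a') using TensorProduct.induction_on with
  | zero => simp
  | tmul x y => simp
  | add x y hx hy => simp only [TensorProduct.add_tmul, TensorProduct.tmul_add, map_add, hx, hy]

theorem preTwist_tmul (τ : B ⊗[k] A →ₗ[k] A ⊗[k] B) (b₁ b₂ : B) (a₁ a₂ : A) :
    preTwist k τ ((b₁ ⊗ₜ b₂) ⊗ₜ (a₁ ⊗ₜ a₂)) =
      TensorProduct.map (TensorProduct.mk k B A b₁) ((TensorProduct.mk k B A).flip a₂)
        (τ (b₂ ⊗ₜ a₁)) := by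
  simp only [preTwist, LinearMap.comp_apply, LinearEquiv.coe_coe,
    TensorProduct.assoc_tmul, TensorProduct.assoc_symm_tmul, TensorProduct.map_tmul,
    LinearMap.id_apply]
  induction τ (b₂ ⊗ₜ a₁) using TensorProduct.induction_on with
  | zero => simp
  | tmul x y => simp
  | add x y hx hy => simp only [TensorProduct.add_tmul, TensorProduct.tmul_add, map_add, hx, hy]

/-- The multiplicativity condition with first argument `1 : B`. -/
theorem ttpMul_map_one_left (τ : B ⊗[k] A →ₗ[k] A ⊗[k] B)
    (hu : ∀ a : A, τ ((1 : B) ⊗ₜ[k] a) = a ⊗ₜ[k] (1 : B)) (a₂ : A) (x : A ⊗[k] B) :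
    ttpMul k (LinearMap.mul' k A) (LinearMap.mul' k B) τ (TensorProduct.map τ τ
      (TensorProduct.map (TensorProduct.mk k B A 1) ((TensorProduct.mk k B A).flip a₂) x))
      = twistLeft τ (x ⊗ₜ a₂) := by
  induction x using TensorProduct.induction_on with
  | zero => simp
  | add x y hx hy => simp only [TensorProduct.add_tmul, map_add, hx, hy]
  | tmul a b =>
    simp only [TensorProduct.map_tmul, TensorProduct.mk_apply, LinearMap.flip_apply, hu,
      twistLeft_tmul]
    induction τ (b ⊗ₜ a₂) using TensorProduct.induction_on with
    | zero => simp
    | tmul x y => simp [ttpMul_tmul, hu]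
    | add x y hx hy => simp only [TensorProduct.tmul_add, map_add, hx, hy]

/-- The multiplicativity condition with last argument `1 : A`. -/
theorem ttpMul_map_one_right (τ : B ⊗[k] A →ₗ[k] A ⊗[k] B)
    (hu : ∀ b : B, τ (b ⊗ₜ[k] (1 : A)) = (1 : A) ⊗ₜ[k] b) (b₁ : B) (x : A ⊗[k] B) :
    ttpMul k (LinearMap.mul' k A) (LinearMap.mul' k B) τ (TensorProduct.map τ τ
      (TensorProduct.map (TensorProduct.mk k B A b₁) ((TensorProduct.mk k B A).flip 1) x))
      = twistRight τ (b₁ ⊗ₜ x) := by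
  induction x using TensorProduct.induction_on with
  | zero => simp
  | add x y hx hy => simp only [TensorProduct.tmul_add, map_add, hx, hy]
  | tmul a b =>
    simp only [TensorProduct.map_tmul, TensorProduct.mk_apply, LinearMap.flip_apply, hu,
      twistRight_tmul]
    induction τ (b₁ ⊗ₜ a) using TensorProduct.induction_on with
    | zero => simp
    | tmul x y => simp [ttpMul_tmul, hu]
    | add x y hx hy => simp only [TensorProduct.add_tmul, map_add, hx, hy]

theorem twistRight_twistLeft (τ : B ⊗[k] A →ₗ[k] A ⊗[k] B)
    (hA : ∀ (b : B) (a a' : A), τ (b ⊗ₜ (a * a')) = twistLeft τ (τ (b ⊗ₜ a) ⊗ₜ a'))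
    (b₁ : B) (a₂ : A) (x : A ⊗[k] B) :
    twistRight τ (b₁ ⊗ₜ twistLeft τ (x ⊗ₜ a₂))
      = ttpMul k (LinearMap.mul' k A) (LinearMap.mul' k B) τ (TensorProduct.map τ τ
          (TensorProduct.map (TensorProduct.mk k B A b₁)
            ((TensorProduct.mk k B A).flip a₂) x)) := by
  induction x using TensorProduct.induction_on with
  | zero => simp
  | add x y hx hy => simp only [TensorProduct.add_tmul, TensorProduct.tmul_add, map_add, hx, hy]
  | tmul a b =>
    simp only [TensorProduct.map_tmul, TensorProduct.mk_apply, LinearMap.flip_apply,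
      twistLeft_tmul]
    induction τ (b ⊗ₜ a₂) using TensorProduct.induction_on with
    | zero => simp
    | add x y hx hy => simp only [TensorProduct.tmul_add, map_add, hx, hy]
    | tmul c d =>
      simp only [TensorProduct.map_tmul, LinearMap.mulLeft_apply, LinearMap.id_apply,
        twistRight_tmul, hA]
      induction τ (b₁ ⊗ₜ a) using TensorProduct.induction_on with
      | zero => simp
      | add x y hx hy => simp only [TensorProduct.add_tmul, map_add, hx, hy]
      | tmul e f =>
        rw [twistLeft_tmul, ttpMul_tmul, ← LinearMap.comp_apply, ← TensorProduct.map_comp,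
          LinearMap.id_comp, LinearMap.comp_id]

end TwistingMapHelpers

/-!
Statement 5: For a bijective `k`-linear map `τ : B ⊗ A → A ⊗ B` satisfying the unit
conditions, the multiplicativity condition
`τ ∘ (∇_B ⊗ ∇_A) = (∇_A ⊗ ∇_B) ∘ (1 ⊗ τ ⊗ 1) ∘ (τ ⊗ τ) ∘ (1 ⊗ τ ⊗ 1)`
holds iff the two "one-sided" compatibility conditions with `∇_A` and `∇_B` hold.
-/

theorem twisting_map_condition_splits
    {k A B : Type*} [Field k] [Ring A] [Algebra k A] [Ring B] [Algebra k B]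
    (τ : B ⊗[k] A →ₗ[k] A ⊗[k] B)
    (hbij : Function.Bijective τ)
    (hu1 : ∀ b : B, τ (b ⊗ₜ[k] (1 : A)) = (1 : A) ⊗ₜ[k] b)
    (hu2 : ∀ a : A, τ ((1 : B) ⊗ₜ[k] a) = a ⊗ₜ[k] (1 : B)) :
    -- the full multiplicativity condition
    (τ ∘ₗ TensorProduct.map (LinearMap.mul' k B) (LinearMap.mul' k A)
        = ttpMul k (LinearMap.mul' k A) (LinearMap.mul' k B) τ
            ∘ₗ TensorProduct.map τ τ ∘ₗ preTwist k τ)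
    ↔
    -- τ ∘ (1_B ⊗ ∇_A) = (∇_A ⊗ 1_B) ∘ (1_A ⊗ τ) ∘ (τ ⊗ 1_A)  on  B ⊗ (A ⊗ A)
    ((τ ∘ₗ TensorProduct.map (LinearMap.id : B →ₗ[k] B) (LinearMap.mul' k A)
        = TensorProduct.map (LinearMap.mul' k A) (LinearMap.id : B →ₗ[k] B)
            ∘ₗ (TensorProduct.assoc k A A B).symm.toLinearMap
            ∘ₗ TensorProduct.map (LinearMap.id : A →ₗ[k] A) τ
            ∘ₗ (TensorProduct.assoc k A B A).toLinearMap
            ∘ₗ TensorProduct.map τ (LinearMap.id : A →ₗ[k] A)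
            ∘ₗ (TensorProduct.assoc k B A A).symm.toLinearMap) ∧
    -- τ ∘ (∇_B ⊗ 1_A) = (1_A ⊗ ∇_B) ∘ (τ ⊗ 1_B) ∘ (1_B ⊗ τ)  on  (B ⊗ B) ⊗ A
     (τ ∘ₗ TensorProduct.map (LinearMap.mul' k B) (LinearMap.id : A →ₗ[k] A)
        = TensorProduct.map (LinearMap.id : A →ₗ[k] A) (LinearMap.mul' k B)
            ∘ₗ (TensorProduct.assoc k A B B).toLinearMap
            ∘ₗ TensorProduct.map τ (LinearMap.id : B →ₗ[k] B)
            ∘ₗ (TensorProduct.assoc k B A B).symm.toLinearMap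
            ∘ₗ TensorProduct.map (LinearMap.id : B →ₗ[k] B) τ
            ∘ₗ (TensorProduct.assoc k B B A).toLinearMap)) := by
  constructor
  · intro h
    have hmul (b₁ b₂ : B) (a₁ a₂ : A) := LinearMap.congr_fun h ((b₁ ⊗ₜ b₂) ⊗ₜ (a₁ ⊗ₜ a₂))
    simp only [LinearMap.comp_apply, TensorProduct.map_tmul, LinearMap.mul'_apply,
      preTwist_tmul] at hmul
    constructor
    · refine TensorProduct.ext_threefold' fun b a a' => ?_
      have := hmul 1 b a a'
      rw [one_mul, ttpMul_map_one_left τ hu2] at this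
      exact this
    · refine TensorProduct.ext_threefold fun b b' a => ?_
      have := hmul b b' a 1
      rw [mul_one, ttpMul_map_one_right τ hu1] at this
      exact this
  · rintro ⟨hA, hB⟩
    have hA' (b : B) (a a' : A) : τ (b ⊗ₜ (a * a')) = twistLeft τ (τ (b ⊗ₜ a) ⊗ₜ a') :=
      LinearMap.congr_fun hA (b ⊗ₜ (a ⊗ₜ a'))
    have hB' (b b' : B) (a : A) : τ ((b * b') ⊗ₜ a) = twistRight τ (b ⊗ₜ τ (b' ⊗ₜ a)) :=
      LinearMap.congr_fun hB ((b ⊗ₜ b') ⊗ₜ a)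
    refine TensorProduct.ext_fourfold' fun b₁ b₂ a₁ a₂ => ?_
    simp only [LinearMap.comp_apply, TensorProduct.map_tmul, LinearMap.mul'_apply,
      preTwist_tmul]
    rw [hB', hA', twistRight_twistLeft τ hA']
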